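/- Let X, Y be free and identically distributed with a free Gamma distribution (X^{-1}, Y^{-1} free Poisson with rate λ > 1, jump size 1). Then R_3(Y X^{-1}, X^{-1} Y, X) = 0. -/

import Mathlib

open scoped Classical
open Finset

noncomputable section

namespace FreeProbLukacs

variable {A : Type*}

/-- Ordered (non-commutative) product of a tuple. -/
def tprod [Monoid A] {n : ℕ} (X : Fin n → A) : A := (List.ofFn X).prod

/-- `P` is a partition of `Fin n`: a finset of nonempty blocks, each point in a unique block. -/
def IsPartition {n : ℕ} (P : Finset (Finset (Fin n))) : Prop :=
  (∀ B ∈ P, B.Nonempty) ∧ ∀ i : Fin n, ∃! B, B ∈ P ∧ i ∈ B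

/-- `P` is non-crossing: there are no `a < b < c < d` with `a, c` in one block and
`b, d` in a different block. -/
def IsNonCrossing {n : ℕ} (P : Finset (Finset (Fin n))) : Prop :=
  ∀ B₁ ∈ P, ∀ B₂ ∈ P, ∀ a ∈ B₁, ∀ b ∈ B₂, ∀ c ∈ B₁, ∀ d ∈ B₂,
    a < b → b < c → c < d → B₁ = B₂

/-- The finset of all non-crossing partitions of `Fin n`. -/
def NC (n : ℕ) : Finset (Finset (Finset (Fin n))) :=
  univ.filter fun P => IsPartition P ∧ IsNonCrossing P

/-- The cumulant functional `R` applied to the entries of `X` lying in a block `B`,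
taken in increasing order of position. -/
def blockCum (R : ∀ n, (Fin n → A) → ℂ) {n : ℕ} (X : Fin n → A) (B : Finset (Fin n)) : ℂ :=
  R B.card fun j => X ((B.sort (· ≤ ·)).get (Fin.cast (Finset.length_sort (· ≤ ·)).symm j))

/-- Product of block cumulants over the blocks of a partition. -/
def partCum (R : ∀ n, (Fin n → A) → ℂ) {n : ℕ} (X : Fin n → A)
    (P : Finset (Finset (Fin n))) : ℂ :=
  ∏ B ∈ P, blockCum R X B

/-- The moment–cumulant formula: `R` is the family of free cumulants of `φ`. -/
def MomentCumulant [Monoid A] (φ : A → ℂ) (R : ∀ n, (Fin n → A) → ℂ) : Prop :=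
  ∀ (n : ℕ) (X : Fin n → A), φ (tprod X) = ∑ P ∈ NC n, partCum R X P

/-- Density of the absolutely continuous part of the Marchenko–Pastur law. -/
def freePoissonDensity (l a x : ℝ) : ℝ :=
  Real.sqrt (4 * l * a ^ 2 - (x - a * (1 + l)) ^ 2) / (2 * Real.pi * a * x)

/-- The free Poisson (Marchenko–Pastur) distribution with rate `l` and jump size `a`. -/
def freePoissonMeasure (l a : ℝ) : MeasureTheory.Measure ℝ :=
  ENNReal.ofReal (max 0 (1 - l)) • MeasureTheory.Measure.dirac 0 +
    MeasureTheory.volume.withDensity fun x => ENNReal.ofReal (freePoissonDensity l a x)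

/-- `X` has distribution `μ` in the sense of moments. -/
def HasMoments [Monoid A] (φ : A → ℂ) (X : A) (μ : MeasureTheory.Measure ℝ) : Prop :=
  ∀ r : ℕ, φ (X ^ r) = ((∫ t, t ^ r ∂μ : ℝ) : ℂ)

/-- `φ` is a state: unital and positive. -/
def IsState [Ring A] [StarRing A] [Module ℂ A] (φ : A →ₗ[ℂ] ℂ) : Prop :=
  φ 1 = 1 ∧ ∀ a : A, ∃ r : ℝ, 0 ≤ r ∧ φ (star a * a) = (r : ℂ)

/-- `φ` is faithful. -/
def Faithful [Ring A] [StarRing A] [Module ℂ A] (φ : A →ₗ[ℂ] ℂ) : Prop :=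
  ∀ a : A, φ (star a * a) = 0 → a = 0

/-- `φ` is tracial. -/
def Tracial [Ring A] [Module ℂ A] (φ : A →ₗ[ℂ] ℂ) : Prop :=
  ∀ a b : A, φ (a * b) = φ (b * a)

/-- All mixed cumulants with entries from `S` and from `T` vanish. -/
def MixedVanish (R : ∀ n, (Fin n → A) → ℂ) (S T : Set A) : Prop :=
  ∀ (n : ℕ) (f : Fin n → A), (∀ i, f i ∈ S ∪ T) → (∃ i, f i ∈ S) → (∃ j, f j ∈ T) →
    R n f = 0

/-- Two elements are free: all their mixed free cumulants vanish. -/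
def FreeElems (R : ∀ n, (Fin n → A) → ℂ) (x y : A) : Prop :=
  MixedVanish R {x} {y}

/-- Interleaving of a partition `P` (placed at positions `1,2,…,n`, i.e. evens)
and `Q` (placed at positions `1̄,…,n̄`, i.e. odds) inside `Fin (2 * n)`. -/
def interleave {n : ℕ} (P Q : Finset (Finset (Fin n))) : Finset (Finset (Fin (2 * n))) :=
  P.image (fun B => B.image fun i => (⟨2 * i.1, by have := i.isLt; omega⟩ : Fin (2 * n)))
    ∪ Q.image (fun B => B.image fun i => (⟨2 * i.1 + 1, by have := i.isLt; omega⟩ : Fin (2 * n)))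

/-- `Q` refines ... : every block of `P` is contained in a block of `Q`. -/
def Refines {n : ℕ} (P Q : Finset (Finset (Fin n))) : Prop :=
  ∀ B ∈ P, ∃ C ∈ Q, B ⊆ C

/-- `Q` is the Kreweras complement of `P`: the largest partition whose interleaving
with `P` is non-crossing. -/
def IsKrewerasComplement {n : ℕ} (P Q : Finset (Finset (Fin n))) : Prop :=
  IsPartition Q ∧ IsNonCrossing (interleave P Q) ∧
    ∀ Q', IsPartition Q' → IsNonCrossing (interleave P Q') → Refines Q' Q

end FreeProbLukacs
namespace FreeProbLukacs

/-- A cumulant functional evaluated on a list. -/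
def listCum {A : Type*} (R : ∀ n, (Fin n → A) → ℂ) (L : List A) : ℂ := R L.length L.get

/-- `f` sends each point to the least element of its block in a non-crossing partition. -/
def IsMinMap {n : ℕ} (f : Fin n → Fin n) : Prop :=
  (∀ i, f i ≤ i) ∧ (∀ i, f (f i) = f i) ∧
    ∀ a b, a < b → f a ≠ f b → ∀ c, b < c → f a = f c → ∀ d, c < d → f b ≠ f d

instance {n : ℕ} (f : Fin n → Fin n) : Decidable (IsMinMap f) := by
  unfold IsMinMap; infer_instance

/-- The block of `f` with least element `i`. -/
def fiber {n : ℕ} (f : Fin n → Fin n) (i : Fin n) : List (Fin n) :=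
  (List.finRange n).filter fun j => f j = i

/-- The least elements of the blocks of `f`. -/
def roots {n : ℕ} (f : Fin n → Fin n) : List (Fin n) :=
  (List.finRange n).filter fun i => f i = i

/-- The partition with least-element map `f`. -/
def blocks {n : ℕ} (f : Fin n → Fin n) : Finset (Finset (Fin n)) :=
  (roots f).toFinset.image fun i => (fiber f i).toFinset

/-- The product of the cumulants over the blocks of `f`. -/
def mapCum {A : Type*} (R : ∀ n, (Fin n → A) → ℂ) {n : ℕ} (X : Fin n → A)
    (f : Fin n → Fin n) : ℂ :=
  ((roots f).map fun i => listCum R ((fiber f i).map X)).prod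

theorem mem_fiber {n : ℕ} {f : Fin n → Fin n} {i j : Fin n} : j ∈ fiber f i ↔ f j = i := by
  simp [fiber]

theorem mem_roots {n : ℕ} {f : Fin n → Fin n} {i : Fin n} : i ∈ roots f ↔ f i = i := by
  simp [roots]

theorem blockCum_eq_listCum {A : Type*} (R : ∀ n, (Fin n → A) → ℂ) {n : ℕ} (X : Fin n → A)
    (B : Finset (Fin n)) : blockCum R X B = listCum R ((B.sort (· ≤ ·)).map X) := by
  have key : ∀ (m : ℕ) (L : List (Fin n)) (h : L.length = m),
      (R m fun j => X (L.get (Fin.cast h.symm j))) = listCum R (L.map X) := by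
    rintro m L rfl
    have key' : ∀ (L' : List A) (h : L'.length = L.length),
        L' = L.map X → (R L.length fun j => L'.get (Fin.cast h.symm j)) = listCum R L' := by
      intro L' h e
      unfold listCum
      clear e
      generalize L.length = k at h
      subst h
      rfl
    rw [← key' (L.map X) (by simp) rfl]
    congr 1
    ext j
    simp
  exact key _ _ (Finset.length_sort _)

theorem sort_fiber {n : ℕ} (f : Fin n → Fin n) (i : Fin n) :
    (fiber f i).toFinset.sort (· ≤ ·) = fiber f i := by
  apply (List.toFinset_sort _ _).2
  · exact ((List.pairwise_lt_finRange n).filter _).imp le_of_lt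
  · exact (List.nodup_finRange n).filter _

theorem partCum_blocks {A : Type*} (R : ∀ n, (Fin n → A) → ℂ) {n : ℕ} (X : Fin n → A)
    (f : Fin n → Fin n) : partCum R X (blocks f) = mapCum R X f := by
  have hinj : Set.InjOn (fun i => (fiber f i).toFinset) ((roots f).toFinset : Set (Fin n)) := by
    intro i hi j hj h
    have hi' : f i = i := by simpa [mem_roots] using hi
    have : i ∈ (fiber f j).toFinset := by
      rw [← show (fiber f i).toFinset = (fiber f j).toFinset from h]
      simpa [mem_fiber] using hi'
    rw [List.mem_toFinset, mem_fiber, hi'] at this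
    exact this
  rw [partCum, blocks, Finset.prod_image hinj,
    List.prod_toFinset _ (show (roots f).Nodup from (List.nodup_finRange n).filter _), mapCum]
  simp only [blockCum_eq_listCum, sort_fiber]

theorem mem_blocks {n : ℕ} {f : Fin n → Fin n} (hf : IsMinMap f) {B : Finset (Fin n)} :
    B ∈ blocks f ↔ ∃ i, B = univ.filter fun j => f j = f i := by
  have h : ∀ i, (fiber f i).toFinset = univ.filter fun j => f j = i := by
    intro i; ext j; simp [mem_fiber]
  simp only [blocks, mem_image, List.mem_toFinset, mem_roots, h]
  constructor
  · rintro ⟨i, hi, rfl⟩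
    exact ⟨i, by rw [hi]⟩
  · rintro ⟨i, rfl⟩
    exact ⟨f i, hf.2.1 i, rfl⟩

theorem blocks_mem_NC {n : ℕ} {f : Fin n → Fin n} (hf : IsMinMap f) : blocks f ∈ NC n := by
  simp only [NC, mem_filter, mem_univ, true_and]
  refine ⟨⟨?_, ?_⟩, ?_⟩
  · intro B hB
    obtain ⟨i, rfl⟩ := (mem_blocks hf).1 hB
    exact ⟨i, by simp⟩
  · intro i
    refine ⟨univ.filter fun j => f j = f i, ⟨(mem_blocks hf).2 ⟨i, rfl⟩, by simp⟩, ?_⟩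
    rintro B ⟨hB, hi⟩
    obtain ⟨k, rfl⟩ := (mem_blocks hf).1 hB
    simp only [mem_filter, mem_univ, true_and] at hi
    rw [hi]
  · intro B₁ h₁ B₂ h₂ a ha b hb c hc d hd hab hbc hcd
    obtain ⟨i, rfl⟩ := (mem_blocks hf).1 h₁
    obtain ⟨k, rfl⟩ := (mem_blocks hf).1 h₂
    simp only [mem_filter, mem_univ, true_and] at ha hb hc hd
    have : f a = f b := by
      by_contra hne
      exact hf.2.2 a b hab hne c hbc (ha.trans hc.symm) d hcd (hb.trans hd.symm)
    rw [← ha, ← hb, this]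

theorem blocks_injOn {n : ℕ} : Set.InjOn (blocks (n := n)) {f | IsMinMap f} := by
  have key : ∀ f g : Fin n → Fin n, IsMinMap f → IsMinMap g → blocks f = blocks g →
      ∀ i, g i ≤ f i := by
    intro f g hf hg h i
    have : (univ.filter fun j => f j = f i) ∈ blocks g := h ▸ (mem_blocks hf).2 ⟨i, rfl⟩
    obtain ⟨k, hk⟩ := (mem_blocks hg).1 this
    have h1 : g i = g k := by
      have : i ∈ univ.filter fun j => f j = f i := by simp
      rw [hk] at this
      simpa using this
    have h2 : g (f i) = g k := by
      have : f i ∈ univ.filter fun j => f j = f i := by simp [hf.2.1]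
      rw [hk] at this
      simpa using this
    rw [h1, ← h2]
    exact hg.1 _
  intro f hf g hg h
  ext1 i
  exact le_antisymm (key g f hg hf h.symm i) (key f g hf hg h i)

theorem exists_isMinMap {n : ℕ} {P : Finset (Finset (Fin n))} (hP : P ∈ NC n) :
    ∃ f, IsMinMap f ∧ blocks f = P := by
  simp only [NC, mem_filter, mem_univ, true_and] at hP
  obtain ⟨⟨hne, huniq⟩, hnc⟩ := hP
  choose b hb hbu using huniq
  have hbu' : ∀ {B i}, B ∈ P → i ∈ B → B = b i := fun hB hi => hbu _ _ ⟨hB, hi⟩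
  let f : Fin n → Fin n := fun i => (b i).min' ⟨i, (hb i).2⟩
  have hfm : ∀ i, f i ∈ b i := fun i => Finset.min'_mem _ _
  have hbf : ∀ i, b (f i) = b i := fun i => (hbu' (hb i).1 (hfm i)).symm
  have hcongr : ∀ {i j}, b i = b j → f i = f j := by
    intro i j h
    simp only [f, h]
  have hiff : ∀ {i j}, f i = f j ↔ b i = b j := fun {i j} =>
    ⟨fun h => by rw [← hbf i, h, hbf], hcongr⟩
  have hf : IsMinMap f := by
    refine ⟨fun i => Finset.min'_le _ _ (hb i).2, fun i => hcongr (hbf i), ?_⟩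
    intro a c hac hne d hcd had e hde hce
    refine hne (hiff.2 (hnc _ (hb a).1 _ (hb c).1 a (hb a).2 c (hb c).2 d ?_ e ?_ hac hcd hde))
    · rw [hiff.1 had]; exact (hb d).2
    · rw [hiff.1 hce]; exact (hb e).2
  have hfil : ∀ i, (univ.filter fun j => f j = f i) = b i := by
    intro i
    ext j
    simp only [mem_filter, mem_univ, true_and, hiff]
    exact ⟨fun h => h ▸ (hb j).2, fun h => (hbu' (hb i).1 h).symm⟩
  refine ⟨f, hf, ?_⟩
  ext B
  rw [mem_blocks hf]
  constructor
  · rintro ⟨i, rfl⟩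
    rw [hfil]
    exact (hb i).1
  · intro hB
    obtain ⟨i, hi⟩ := hne B hB
    exact ⟨i, by rw [hfil]; exact hbu' hB hi⟩

theorem sum_NC {A : Type*} (R : ∀ n, (Fin n → A) → ℂ) {n : ℕ} (X : Fin n → A) :
    ∑ P ∈ NC n, partCum R X P = ∑ f with IsMinMap f, mapCum R X f := by
  have : NC n = (univ.filter fun f : Fin n → Fin n => IsMinMap f).image blocks := by
    ext P
    simp only [mem_image, mem_filter, mem_univ, true_and]
    exact ⟨exists_isMinMap, fun ⟨f, hf, h⟩ => h ▸ blocks_mem_NC hf⟩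
  rw [this, Finset.sum_image (by simpa using blocks_injOn)]
  simp only [partCum_blocks]

theorem mapCum_eq_zero {A : Type*} {R : ∀ n, (Fin n → A) → ℂ} {S T : Set A}
    (h : MixedVanish R S T) {n : ℕ} {X : Fin n → A} {color : Fin n → Bool}
    (hX : ∀ i, X i ∈ if color i then T else S) {f : Fin n → Fin n} (hf : IsMinMap f)
    (hmix : ∃ i, color (f i) ≠ color i) : mapCum R X f = 0 := by
  obtain ⟨i, hi⟩ := hmix
  have hmem : ∀ j, f j = f i → X j ∈ (fiber f (f i)).map X := fun j hj =>
    List.mem_map.2 ⟨j, mem_fiber.2 hj, rfl⟩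
  have hi0 := hmem i rfl
  have hi1 := hmem (f i) (hf.2.1 i)
  have hc0 := hX i
  have hc1 := hX (f i)
  refine List.prod_eq_zero (List.mem_map.2 ⟨f i, mem_roots.2 (hf.2.1 i), ?_⟩)
  obtain ⟨p, hp⟩ := List.get_of_mem hi0
  obtain ⟨q, hq⟩ := List.get_of_mem hi1
  refine h _ _ ?_ ?_ ?_
  · intro k
    obtain ⟨j, -, hj⟩ := List.mem_map.1 (List.get_mem ((fiber f (f i)).map X) k)
    rw [← hj]
    have := hX j
    split_ifs at this
    · exact Or.inr this
    · exact Or.inl this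
  all_goals
    cases h0 : color i <;> cases h1 : color (f i) <;> simp only [h0, h1] at hc0 hc1 hi
    all_goals first
    | exact absurd rfl hi
    | exact ⟨p, hp ▸ hc0⟩
    | exact ⟨q, hq ▸ hc1⟩

theorem moment_eq_sum {A : Type*} [Monoid A] {φ : A → ℂ} {R : ∀ n, (Fin n → A) → ℂ}
    (hmc : MomentCumulant φ R) {n : ℕ} (X : Fin n → A) (E : Finset (Fin n → Fin n))
    (hE : ∀ f ∈ E, IsMinMap f) (h0 : ∀ f, IsMinMap f → f ∉ E → mapCum R X f = 0) :
    φ (tprod X) = ∑ f ∈ E, mapCum R X f := by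
  rw [hmc, sum_NC]
  refine (Finset.sum_subset (fun f hf => by simpa using hE f hf) fun f hf hfE => ?_).symm
  exact h0 f (by simpa using hf) hfE

theorem moment_one {A : Type*} [Monoid A] {φ : A → ℂ} {R : ∀ n, (Fin n → A) → ℂ}
    (hmc : MomentCumulant φ R) (a : A) : φ a = listCum R [a] := by
  have := moment_eq_sum hmc ![a] {![0]} (by decide +kernel)
    (fun f hf hfE => absurd hfE (by revert f; decide +kernel))
  simpa [tprod, mapCum, roots, fiber, List.finRange_succ] using this

theorem moment_two {A : Type*} [Monoid A] {φ : A → ℂ} {R : ∀ n, (Fin n → A) → ℂ}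
    (hmc : MomentCumulant φ R) (a b : A) :
    φ (a * b) = listCum R [a, b] + listCum R [a] * listCum R [b] := by
  have := moment_eq_sum hmc ![a, b] {![0, 0], ![0, 1]} (by decide +kernel)
    (fun f hf hfE => absurd hfE (by revert f; decide +kernel))
  rw [Finset.sum_pair (by decide)] at this
  simpa [tprod, mapCum, roots, fiber, List.finRange_succ] using this

theorem moment_three {A : Type*} [Monoid A] {φ : A → ℂ} {R : ∀ n, (Fin n → A) → ℂ}
    (hmc : MomentCumulant φ R) (a b c : A) :
    φ (a * b * c) = listCum R [a, b, c] + listCum R [a, b] * listCum R [c]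
      + listCum R [a, c] * listCum R [b] + listCum R [a] * listCum R [b, c]
      + listCum R [a] * listCum R [b] * listCum R [c] := by
  have := moment_eq_sum hmc ![a, b, c]
    {![0, 0, 0], ![0, 0, 2], ![0, 1, 0], ![0, 1, 1], ![0, 1, 2]} (by decide +kernel)
    (fun f hf hfE => absurd hfE (by revert f; decide +kernel))
  repeat rw [Finset.sum_insert (by decide)] at this
  rw [Finset.sum_singleton] at this
  simpa [tprod, mapCum, roots, fiber, List.finRange_succ, mul_assoc, add_assoc] using this

theorem moment_abba {A : Type*} [Monoid A] {φ : A → ℂ} {R : ∀ n, (Fin n → A) → ℂ}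
    (hmc : MomentCumulant φ R) {S T : Set A} (h : MixedVanish R S T) {a b : A}
    (ha : a ∈ T) (hb : b ∈ S) : φ (a * b * (b * a)) = φ (a * a) * φ (b * b) := by
  have := moment_eq_sum hmc ![a, b, b, a]
    {![0, 1, 1, 0], ![0, 1, 1, 3], ![0, 1, 2, 0], ![0, 1, 2, 3]} (by decide +kernel)
    (fun f hf hfE => mapCum_eq_zero h (color := ![true, false, false, true])
      (by intro i; fin_cases i <;> simpa) hf (by revert f; decide +kernel))
  repeat rw [Finset.sum_insert (by decide)] at this
  rw [Finset.sum_singleton] at this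
  simp [tprod, mapCum, roots, fiber, List.finRange_succ] at this
  rw [moment_two hmc a a, moment_two hmc b b, mul_assoc, this]
  ring

theorem moment_ab {A : Type*} [Monoid A] {φ : A → ℂ} {R : ∀ n, (Fin n → A) → ℂ}
    (hmc : MomentCumulant φ R) {S T : Set A} (h : MixedVanish R S T) {a b : A}
    (ha : a ∈ T) (hb : b ∈ S) : φ (a * b) = φ a * φ b := by
  have := moment_eq_sum hmc ![a, b] {![0, 1]} (by decide +kernel)
    (fun f hf hfE => mapCum_eq_zero h (color := ![true, false])
      (by intro i; fin_cases i <;> simpa) hf (by revert f; decide +kernel))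
  rw [moment_one hmc a, moment_one hmc b]
  simpa [tprod, mapCum, roots, fiber, List.finRange_succ] using this

theorem moment_abbac {A : Type*} [Monoid A] {φ : A → ℂ} {R : ∀ n, (Fin n → A) → ℂ}
    (hmc : MomentCumulant φ R) {S T : Set A} (h : MixedVanish R S T) {a b c : A}
    (ha : a ∈ T) (hb : b ∈ S) (hc : c ∈ S) :
    φ (a * b * (b * a) * c) = (φ (a * a) - φ a * φ a) * (φ (b * b) * φ c)
      + φ a * φ a * φ (b * b * c) := by
  have := moment_eq_sum hmc ![a, b, b, a, c]
    {![0, 1, 1, 0, 4], ![0, 1, 2, 0, 4], ![0, 1, 1, 3, 1], ![0, 1, 1, 3, 4], ![0, 1, 2, 3, 1],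
      ![0, 1, 2, 3, 2], ![0, 1, 2, 3, 4]} (by decide +kernel)
    (fun f hf hfE => mapCum_eq_zero h (color := ![true, false, false, true, false])
      (by intro i; fin_cases i <;> simp [ha, hb, hc]) hf (by revert f; decide +kernel))
  repeat rw [Finset.sum_insert (by decide)] at this
  rw [Finset.sum_singleton] at this
  simp [tprod, mapCum, roots, fiber, List.finRange_succ] at this
  rw [moment_two hmc a a, moment_two hmc b b, moment_one hmc a, moment_one hmc c,
    moment_three hmc b b c]
  simp only [mul_assoc] at this ⊢
  rw [this]
  ring

open MeasureTheory

/-- The square of `2πx` times the rate-`l` free Poisson density, on the support. -/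
def semicircle (l x : ℝ) : ℝ := 4 * l - (x - (1 + l)) ^ 2

section Support

variable {l : ℝ}

theorem two_sqrt_lt (hl : 1 < l) : 2 * √l < 1 + l := by
  have h1 : 1 < √l := by rw [Real.lt_sqrt zero_le_one]; simpa
  nlinarith [Real.sq_sqrt (show 0 ≤ l by linarith)]

theorem pos_of_mem (hl : 1 < l) {x : ℝ} (hx : x ∈ Set.Icc (1 + l - 2 * √l) (1 + l + 2 * √l)) :
    0 < x := by
  have := two_sqrt_lt hl
  linarith [hx.1]

theorem le_support (l : ℝ) : 1 + l - 2 * √l ≤ 1 + l + 2 * √l := by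
  linarith [Real.sqrt_nonneg l]

theorem semicircle_eq_mul (hl : 1 < l) (x : ℝ) :
    semicircle l x = (x - (1 + l - 2 * √l)) * (1 + l + 2 * √l - x) := by
  have := Real.sq_sqrt (show 0 ≤ l by linarith)
  unfold semicircle
  linear_combination (-4) * this

theorem density_eq (l x : ℝ) :
    freePoissonDensity l 1 x = √(semicircle l x) / (2 * Real.pi * x) := by
  simp [freePoissonDensity, semicircle]

theorem continuous_semicircle : Continuous (semicircle l) := by
  unfold semicircle; fun_prop

theorem density_nonneg (hl : 1 < l) {x : ℝ}
    (hx : x ∈ Set.Icc (1 + l - 2 * √l) (1 + l + 2 * √l)) : 0 ≤ freePoissonDensity l 1 x := by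
  have := pos_of_mem hl hx
  rw [density_eq]
  positivity

theorem continuousOn_density (hl : 1 < l) :
    ContinuousOn (freePoissonDensity l 1) (Set.Icc (1 + l - 2 * √l) (1 + l + 2 * √l)) := by
  have : freePoissonDensity l 1 = fun x => √(semicircle l x) / (2 * Real.pi * x) :=
    funext (density_eq l)
  rw [this]
  refine ContinuousOn.div (continuous_semicircle.sqrt).continuousOn (by fun_prop) ?_
  intro x hx
  have := pos_of_mem hl hx
  positivity

theorem integral_freePoissonMeasure (hl : 1 < l) (g : ℝ → ℝ) :
    ∫ t, g t ∂(freePoissonMeasure l 1) =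
      ∫ x in (1 + l - 2 * √l)..(1 + l + 2 * √l), freePoissonDensity l 1 x * g x := by
  have hmeas : Measurable (freePoissonDensity l 1) := by
    unfold freePoissonDensity; fun_prop
  have h0 : max 0 (1 - l) = 0 := max_eq_left (by linarith)
  rw [freePoissonMeasure, h0, ENNReal.ofReal_zero, zero_smul, zero_add,
    integral_withDensity_eq_integral_toReal_smul hmeas.ennreal_ofReal (by simp),
    intervalIntegral.integral_of_le (le_support l)]
  rw [← setIntegral_eq_integral_of_forall_compl_eq_zero
    (s := Set.Ioc (1 + l - 2 * √l) (1 + l + 2 * √l))]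
  · refine setIntegral_congr_fun measurableSet_Ioc fun x hx => ?_
    simp only [smul_eq_mul]
    rw [ENNReal.toReal_ofReal (density_nonneg hl (Set.Ioc_subset_Icc_self hx))]
  · intro x hx
    have : semicircle l x ≤ 0 := by
      rw [semicircle_eq_mul hl]
      have h1 := le_support l
      rcases le_or_gt x (1 + l - 2 * √l) with h | h
      · exact mul_nonpos_of_nonpos_of_nonneg (by linarith) (by linarith)
      · have : 1 + l + 2 * √l < x := by
          by_contra hc
          exact hx ⟨h, not_lt.1 hc⟩
        exact mul_nonpos_of_nonneg_of_nonpos (by linarith) (by linarith)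
    rw [density_eq, Real.sqrt_eq_zero_of_nonpos this]
    simp

theorem intervalIntegrable_density_mul (hl : 1 < l) {g : ℝ → ℝ}
    (hg : ContinuousOn g (Set.Icc (1 + l - 2 * √l) (1 + l + 2 * √l))) :
    IntervalIntegrable (fun x => freePoissonDensity l 1 x * g x) volume
      (1 + l - 2 * √l) (1 + l + 2 * √l) :=
  ((continuousOn_density hl).mul hg).intervalIntegrable_of_Icc (le_support l)

theorem integral_sqrt_semicircle (hl : 1 < l) :
    ∫ x in (1 + l - 2 * √l)..(1 + l + 2 * √l), √(semicircle l x) = 2 * Real.pi * l := by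
  have hs := Real.sq_sqrt (show 0 ≤ l by linarith)
  have hpos : 0 < 2 * √l := by have := Real.sqrt_pos.2 (show 0 < l by linarith); linarith
  have h := intervalIntegral.integral_comp_mul_add (a := -1) (b := 1)
    (fun x => √(semicircle l x)) hpos.ne' (1 + l)
  have h2 : ∀ u : ℝ, √(semicircle l (2 * √l * u + (1 + l))) = 2 * √l * √(1 - u ^ 2) := by
    intro u
    have : semicircle l (2 * √l * u + (1 + l)) = (2 * √l) ^ 2 * (1 - u ^ 2) := by
      unfold semicircle
      linear_combination (-4) * hs
    rw [this, Real.sqrt_mul (sq_nonneg _), Real.sqrt_sq hpos.le]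
  simp only [h2, intervalIntegral.integral_const_mul, integral_sqrt_one_sub_sq] at h
  rw [show 2 * √l * -1 + (1 + l) = 1 + l - 2 * √l by ring,
    show 2 * √l * 1 + (1 + l) = 1 + l + 2 * √l by ring, smul_eq_mul,
    eq_inv_mul_iff_mul_eq₀ hpos.ne'] at h
  rw [← h]
  linear_combination 2 * Real.pi * hs

theorem integral_density_id (hl : 1 < l) :
    ∫ x in (1 + l - 2 * √l)..(1 + l + 2 * √l), freePoissonDensity l 1 x * x = l := by
  have : ∫ x in (1 + l - 2 * √l)..(1 + l + 2 * √l), freePoissonDensity l 1 x * x =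
      ∫ x in (1 + l - 2 * √l)..(1 + l + 2 * √l), (2 * Real.pi)⁻¹ * √(semicircle l x) := by
    refine intervalIntegral.integral_congr fun x hx => ?_
    rw [Set.uIcc_of_le (le_support l)] at hx
    have := pos_of_mem hl hx
    simp only [density_eq]
    field_simp
  rw [this, intervalIntegral.integral_const_mul, integral_sqrt_semicircle hl]
  field_simp

theorem hasDerivAt_semicircle_rpow (l x : ℝ) :
    HasDerivAt (fun y => semicircle l y ^ (3 / 2 : ℝ))
      (-3 * (x - (1 + l)) * √(semicircle l x)) x := by
  have h1 : HasDerivAt (semicircle l) (-2 * (x - (1 + l))) x := by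
    unfold semicircle
    refine ((((hasDerivAt_id' x).sub_const (1 + l)).pow 2).const_sub (4 * l)).congr_deriv ?_
    push_cast
    ring
  refine (h1.rpow_const (p := 3 / 2) (Or.inr (by norm_num))).congr_deriv ?_
  rw [Real.sqrt_eq_rpow, show (3 / 2 - 1 : ℝ) = 1 / 2 by norm_num]
  ring

theorem integral_density_mul_eq_zero (hl : 1 < l) {g h : ℝ → ℝ}
    (hg : ContinuousOn g (Set.Icc (1 + l - 2 * √l) (1 + l + 2 * √l)))
    (hh : ∀ x ∈ Set.Icc (1 + l - 2 * √l) (1 + l + 2 * √l),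
      HasDerivAt (fun y => semicircle l y ^ (3 / 2 : ℝ) * h y)
        (freePoissonDensity l 1 x * g x) x) :
    ∫ x in (1 + l - 2 * √l)..(1 + l + 2 * √l), freePoissonDensity l 1 x * g x = 0 := by
  rw [intervalIntegral.integral_eq_sub_of_hasDerivAt
    (fun x hx => hh x (by rwa [Set.uIcc_of_le (le_support l)] at hx))
    (intervalIntegrable_density_mul hl hg)]
  simp only [semicircle_eq_mul hl]
  norm_num

theorem integral_density_sq (hl : 1 < l) :
    ∫ x in (1 + l - 2 * √l)..(1 + l + 2 * √l), freePoissonDensity l 1 x * x ^ 2 =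
      l * (1 + l) := by
  have h := integral_density_mul_eq_zero hl
    (g := fun x => 2 * Real.pi * (-3) * (x ^ 2 - (1 + l) * x)) (h := fun _ => 1) (by fun_prop) (by
      intro x hx
      have := pos_of_mem hl hx
      simp only [mul_one]
      refine (hasDerivAt_semicircle_rpow l x).congr_deriv ?_
      rw [density_eq]
      field_simp)
  have e : ∀ x, freePoissonDensity l 1 x * (2 * Real.pi * (-3) * (x ^ 2 - (1 + l) * x)) =
      2 * Real.pi * (-3) * (freePoissonDensity l 1 x * x ^ 2
        - (1 + l) * (freePoissonDensity l 1 x * x)) := fun x => by ring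
  simp only [e] at h
  rw [intervalIntegral.integral_const_mul, intervalIntegral.integral_sub
    (intervalIntegrable_density_mul hl (by fun_prop))
    ((intervalIntegrable_density_mul hl (g := fun x => x) continuousOn_id).const_mul _),
    intervalIntegral.integral_const_mul, integral_density_id hl] at h
  have := Real.pi_pos
  rcases mul_eq_zero.1 h with h | h
  · nlinarith
  · linarith

theorem integral_density_inv (hl : 1 < l)
    (h1 : ∫ x in (1 + l - 2 * √l)..(1 + l + 2 * √l), freePoissonDensity l 1 x * 1 = 1) :
    ∫ x in (1 + l - 2 * √l)..(1 + l + 2 * √l), freePoissonDensity l 1 x * x⁻¹ = (l - 1)⁻¹ := by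
  have hinv : ContinuousOn (fun x : ℝ => x⁻¹) (Set.Icc (1 + l - 2 * √l) (1 + l + 2 * √l)) :=
    continuousOn_inv₀.mono fun x hx => (pos_of_mem hl hx).ne'
  have h := integral_density_mul_eq_zero hl
    (g := fun x => 2 * Real.pi * ((1 + l) * 1 - 2 * x + (l - 1) ^ 2 * x⁻¹))
    (h := fun x => x⁻¹) (by fun_prop) (by
      intro x hx
      have hx0 := pos_of_mem hl hx
      have hq : 0 ≤ semicircle l x := by
        rw [semicircle_eq_mul hl]
        exact mul_nonneg (by linarith [hx.1]) (by linarith [hx.2])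
      refine ((hasDerivAt_semicircle_rpow l x).mul (hasDerivAt_inv hx0.ne')).congr_deriv ?_
      rw [density_eq, show (3 / 2 : ℝ) = 1 + 1 / 2 by norm_num,
        Real.rpow_add_of_nonneg hq (by norm_num) (by norm_num), Real.rpow_one,
        ← Real.sqrt_eq_rpow]
      generalize √(semicircle l x) = s
      unfold semicircle
      field_simp
      ring)
  have e : ∀ x, freePoissonDensity l 1 x *
      (2 * Real.pi * ((1 + l) * 1 - 2 * x + (l - 1) ^ 2 * x⁻¹)) =
      2 * Real.pi * ((1 + l) * (freePoissonDensity l 1 x * 1) - 2 * (freePoissonDensity l 1 x * x)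
        + (l - 1) ^ 2 * (freePoissonDensity l 1 x * x⁻¹)) := fun x => by ring
  simp only [e] at h
  have i1 := (intervalIntegrable_density_mul hl (g := fun _ => 1) continuousOn_const).const_mul
    (1 + l)
  have i2 := (intervalIntegrable_density_mul hl (g := fun x => x) continuousOn_id).const_mul 2
  have i3 := (intervalIntegrable_density_mul hl hinv).const_mul ((l - 1) ^ 2)
  rw [intervalIntegral.integral_const_mul, intervalIntegral.integral_add (i1.sub i2) i3,
    intervalIntegral.integral_sub i1 i2, intervalIntegral.integral_const_mul,
    intervalIntegral.integral_const_mul, intervalIntegral.integral_const_mul, h1,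
    integral_density_id hl] at h
  have hpi := Real.pi_pos
  have hl1 : l - 1 ≠ 0 := by linarith
  rcases mul_eq_zero.1 h with h | h
  · nlinarith
  · rw [← mul_eq_one_iff_eq_inv₀ hl1]
    apply mul_left_cancel₀ hl1
    linear_combination h

end Support

section State

open Polynomial

theorem commute_aeval {A : Type*} [Ring A] [Algebra ℝ A] {a b : A} (h : Commute a b) (p : ℝ[X]) :
    Commute a (aeval b p) := by
  induction p using Polynomial.induction_on' with
  | add p q hp hq => rw [map_add]; exact hp.add_right hq
  | monomial n c =>
    rw [aeval_monomial]
    exact (Algebra.commute_algebraMap_right c a).mul_right (h.pow_right n)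

theorem isSelfAdjoint_aeval {A : Type*} [Ring A] [StarRing A] [Algebra ℂ A] [StarModule ℂ A]
    {W : A} (hW : IsSelfAdjoint W) (p : ℝ[X]) :
    IsSelfAdjoint (aeval W p) := by
  induction p using Polynomial.induction_on' with
  | add p q hp hq => rw [map_add]; exact hp.add hq
  | monomial n a =>
    rw [aeval_monomial, ← Algebra.smul_def]
    exact (IsSelfAdjoint.all a).smul (hW.pow n)

theorem map_aeval {A : Type*} [Ring A] [Algebra ℂ A]
    {φ : A →ₗ[ℂ] ℂ} {W : A} {l : ℝ} (hl : 1 < l)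
    (hW : HasMoments φ W (freePoissonMeasure l 1)) (p : ℝ[X]) :
    φ (aeval W p) = ((∫ x in (1 + l - 2 * √l)..(1 + l + 2 * √l),
      freePoissonDensity l 1 x * p.eval x : ℝ) : ℂ) := by
  induction p using Polynomial.induction_on' with
  | add p q hp hq =>
    rw [map_add, map_add, hp, hq, ← Complex.ofReal_add, ← intervalIntegral.integral_add
      (intervalIntegrable_density_mul hl p.continuousOn)
      (intervalIntegrable_density_mul hl q.continuousOn)]
    simp only [eval_add, mul_add]
  | monomial n a =>
    rw [aeval_monomial, ← Algebra.smul_def, ← Complex.coe_smul, map_smul, hW n,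
      integral_freePoissonMeasure hl, smul_eq_mul, ← Complex.ofReal_mul,
      ← intervalIntegral.integral_const_mul]
    simp only [eval_monomial]
    congr 2
    ext x
    ring

/-- Cauchy–Schwarz, in additive form, for commuting self-adjoint elements. -/
theorem norm_map_mul_le {A : Type*} [Ring A] [StarRing A] [Algebra ℂ A] [StarModule ℂ A]
    {φ : A →ₗ[ℂ] ℂ} (hst : IsState φ) {a b : A} (ha : IsSelfAdjoint a)
    (hb : IsSelfAdjoint b) (hab : Commute a b) {ε : ℝ} (hε : 0 < ε) :
    2 * ε * ‖φ (a * b)‖ ≤ ε ^ 2 * ‖φ (a * a)‖ + ‖φ (b * b)‖ := by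
  have hεa : IsSelfAdjoint (ε • a) := (IsSelfAdjoint.all ε).smul ha
  obtain ⟨r, hr, h1⟩ := hst.2 (ε • a + b)
  obtain ⟨s, hs, h2⟩ := hst.2 (ε • a - b)
  have e : φ (ε • a * (ε • a)) = ε ^ 2 * φ (a * a) := by
    rw [smul_mul_smul_comm, ← Complex.coe_smul, map_smul, smul_eq_mul]
    push_cast
    ring
  have e' : φ (ε • a * b) = ε * φ (a * b) := by
    rw [smul_mul_assoc, ← Complex.coe_smul, map_smul, smul_eq_mul]
  have e'' : φ (b * (ε • a)) = ε * φ (a * b) := by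
    rw [mul_smul_comm, ← Complex.coe_smul, map_smul, smul_eq_mul, hab.eq]
  rw [(hεa.add hb).star_eq, mul_add, add_mul, add_mul, map_add, map_add, map_add, e, e', e''] at h1
  rw [(hεa.sub hb).star_eq, mul_sub, sub_mul, sub_mul, map_sub, map_sub, map_sub, e, e', e''] at h2
  have h3 : ((2 * ε : ℝ) : ℂ) * φ (a * b) = ((r - s) / 2 : ℝ) := by
    push_cast
    linear_combination (h1 - h2) / 2
  have h4 : ((ε ^ 2 : ℝ) : ℂ) * φ (a * a) + φ (b * b) = ((r + s) / 2 : ℝ) := by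
    push_cast
    linear_combination (h1 + h2) / 2
  calc 2 * ε * ‖φ (a * b)‖ = ‖((2 * ε : ℝ) : ℂ) * φ (a * b)‖ := by
        rw [norm_mul, Complex.norm_real, Real.norm_of_nonneg (by positivity)]
    _ = |(r - s) / 2| := by rw [h3, Complex.norm_real, Real.norm_eq_abs]
    _ ≤ |(r + s) / 2| := by
        rw [abs_of_nonneg (show 0 ≤ (r + s) / 2 by positivity), abs_le]
        constructor <;> linarith
    _ = ‖((ε ^ 2 : ℝ) : ℂ) * φ (a * a) + φ (b * b)‖ := by
        rw [h4, Complex.norm_real, Real.norm_eq_abs]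
    _ ≤ ‖((ε ^ 2 : ℝ) : ℂ) * φ (a * a)‖ + ‖φ (b * b)‖ := norm_add_le _ _
    _ = ε ^ 2 * ‖φ (a * a)‖ + ‖φ (b * b)‖ := by
        rw [norm_mul, Complex.norm_real, Real.norm_of_nonneg (by positivity)]

theorem integral_density_one {A : Type*} [Ring A] [StarRing A] [Algebra ℂ A]
    {φ : A →ₗ[ℂ] ℂ} (hst : IsState φ) {W : A} {l : ℝ} (hl : 1 < l)
    (hW : HasMoments φ W (freePoissonMeasure l 1)) :
    ∫ x in (1 + l - 2 * √l)..(1 + l + 2 * √l), freePoissonDensity l 1 x * 1 = 1 := by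
  have h := hW 0
  rw [pow_zero, hst.1, integral_freePoissonMeasure hl] at h
  simpa using (Complex.ofReal_injective (by simpa using h)).symm

theorem abs_integral_density_mul_le {l : ℝ} (hl : 1 < l)
    (h1 : ∫ x in (1 + l - 2 * √l)..(1 + l + 2 * √l), freePoissonDensity l 1 x * 1 = 1)
    {g : ℝ → ℝ} {C : ℝ} (hg : ContinuousOn g (Set.Icc (1 + l - 2 * √l) (1 + l + 2 * √l)))
    (hC : ∀ x ∈ Set.Icc (1 + l - 2 * √l) (1 + l + 2 * √l), |g x| ≤ C) :
    |∫ x in (1 + l - 2 * √l)..(1 + l + 2 * √l), freePoissonDensity l 1 x * g x| ≤ C := by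
  have hc := (intervalIntegrable_density_mul hl (g := fun _ => (1 : ℝ)) continuousOn_const)
  have hi := intervalIntegrable_density_mul hl hg
  have hu := intervalIntegral.integral_mono_on (le_support l) hi (hc.const_mul C) fun x hx => by
    have := mul_le_mul_of_nonneg_left (abs_le.1 (hC x hx)).2 (density_nonneg hl hx)
    linarith
  have hd := intervalIntegral.integral_mono_on (le_support l) (hc.const_mul (-C)) hi fun x hx => by
    have := mul_le_mul_of_nonneg_left (abs_le.1 (hC x hx)).1 (density_nonneg hl hx)
    linarith
  rw [intervalIntegral.integral_const_mul, h1] at hu hd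
  rw [abs_le]
  constructor <;> linarith

/-- The inverse of a free Poisson element of rate `l > 1` has mean `1 / (l - 1)`. -/
theorem map_inverse_freePoisson {A : Type*} [Ring A] [StarRing A] [Algebra ℂ A] [StarModule ℂ A]
    {φ : A →ₗ[ℂ] ℂ} (hst : IsState φ) {X W : A}
    (hX : IsSelfAdjoint X) (hW : IsSelfAdjoint W) (hXW : X * W = 1) (hWX : W * X = 1)
    {l : ℝ} (hl : 1 < l) (hmom : HasMoments φ W (freePoissonMeasure l 1)) :
    φ X = (((l - 1)⁻¹ : ℝ) : ℂ) := by
  have h1 := integral_density_one hst hl hmom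
  rw [← integral_density_inv hl h1, ← sub_eq_zero, ← norm_le_zero_iff]
  set a := 1 + l - 2 * √l
  set b := 1 + l + 2 * √l
  have hinv : ContinuousOn (fun x : ℝ => x⁻¹) (Set.Icc a b) :=
    continuousOn_inv₀.mono fun x hx => (pos_of_mem hl hx).ne'
  have main : ∀ ε : ℝ, 0 < ε →
      ‖φ X - ((∫ x in a..b, freePoissonDensity l 1 x * x⁻¹ : ℝ) : ℂ)‖ ≤
        ε * ((‖φ (X * X)‖ + b ^ 2) / 2 + 1) := by
    intro ε hε
    obtain ⟨p, hp⟩ := exists_polynomial_near_of_continuousOn a b _ hinv ε hε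
    have hD : aeval W (1 - Polynomial.X * p) = 1 - W * aeval W p := by simp
    have hXp : X * aeval W (1 - Polynomial.X * p) = X - aeval W p := by
      rw [hD, mul_sub, mul_one, ← mul_assoc, hXW, one_mul]
    have hcomm : Commute X (aeval W (1 - Polynomial.X * p)) := by
      exact commute_aeval (show Commute X W from hXW.trans hWX.symm) _
    have hCS := norm_map_mul_le hst hX (isSelfAdjoint_aeval hW (1 - Polynomial.X * p)) hcomm hε
    rw [hXp, ← map_mul, map_aeval hl hmom, map_sub, map_aeval hl hmom, Complex.norm_real,
      Real.norm_eq_abs] at hCS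
    have hD2 : |∫ x in a..b, freePoissonDensity l 1 x *
        ((1 - Polynomial.X * p) * (1 - Polynomial.X * p)).eval x| ≤ (b * ε) ^ 2 := by
      refine abs_integral_density_mul_le hl h1 (Polynomial.continuousOn _) fun x hx => ?_
      have hx0 := pos_of_mem hl hx
      have : |1 - x * p.eval x| ≤ b * ε := by
        have e : 1 - x * p.eval x = -(x * (p.eval x - x⁻¹)) := by field_simp; ring
        rw [e, abs_neg, abs_mul, abs_of_pos hx0]
        exact mul_le_mul hx.2 (hp x hx).le (abs_nonneg _) (hx0.le.trans hx.2)
      rw [eval_mul, ← pow_two, abs_of_nonneg (sq_nonneg _)]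
      simp only [eval_sub, eval_one, eval_mul, eval_X]
      exact sq_le_sq' (by linarith [(abs_le.1 this).1]) (abs_le.1 this).2
    have hp2 : |(∫ x in a..b, freePoissonDensity l 1 x * p.eval x) -
        ∫ x in a..b, freePoissonDensity l 1 x * x⁻¹| ≤ ε := by
      rw [← intervalIntegral.integral_sub (intervalIntegrable_density_mul hl p.continuousOn)
        (intervalIntegrable_density_mul hl hinv)]
      simp only [← mul_sub]
      exact abs_integral_density_mul_le hl h1 (p.continuousOn.sub hinv) fun x hx => (hp x hx).le
    rw [← Real.norm_eq_abs, ← Complex.norm_real, Complex.ofReal_sub] at hp2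
    refine (norm_sub_le_norm_sub_add_norm_sub _ _ _).trans (add_le_add ?_ hp2 |>.trans
      (b := ε * ((‖φ (X * X)‖ + b ^ 2) / 2) + ε) (le_of_eq (by ring)))
    refine le_of_mul_le_mul_left ?_ (show 0 < 2 * ε by positivity)
    nlinarith
  refine le_of_forall_pos_le_add fun δ hδ => ?_
  have hC : 0 < (‖φ (X * X)‖ + b ^ 2) / 2 + 1 := by positivity
  have := main (δ / ((‖φ (X * X)‖ + b ^ 2) / 2 + 1)) (by positivity)
  rwa [div_mul_cancel₀ _ hC.ne', ← zero_add δ] at this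

end State

/-- for `X, Y` free and identically free Gamma distributed (i.e. `X⁻¹`, `Y⁻¹`
free Poisson with rate `l > 1`, jump size 1), `R_3(YX⁻¹, X⁻¹Y, X) = 0`. -/
theorem free_gamma_third_cumulant_X
    {A : Type*} [NormedRing A] [StarRing A] [CStarRing A] [CompleteSpace A]
    [NormedAlgebra ℂ A] [StarModule ℂ A]
    (φ : A →ₗ[ℂ] ℂ) (R : ∀ n, (Fin n → A) → ℂ)
    (hst : IsState φ) (hfa : Faithful φ) (htr : Tracial φ)
    (hmc : MomentCumulant (⇑φ) R)
    (X Y : A) (hXsa : IsSelfAdjoint X) (hYsa : IsSelfAdjoint Y)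
    (hUX : IsUnit X) (hUY : IsUnit Y)
    (l : ℝ) (hl : 1 < l)
    (hmomX : HasMoments (⇑φ) (Ring.inverse X) (freePoissonMeasure l 1))
    (hmomY : HasMoments (⇑φ) (Ring.inverse Y) (freePoissonMeasure l 1))
    (hid : ∀ r : ℕ, φ (X ^ r) = φ (Y ^ r))
    (hfree : MixedVanish R ({X, Ring.inverse X} : Set A) ({Y, Ring.inverse Y} : Set A)) :
    R 3 ![Y * Ring.inverse X, Ring.inverse X * Y, X] = 0 := by
  have hXW : X * Ring.inverse X = 1 := Ring.mul_inverse_cancel X hUX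
  have hWX : Ring.inverse X * X = 1 := Ring.inverse_mul_cancel X hUX
  set W := Ring.inverse X with hWdef
  have hWsa : IsSelfAdjoint W := hXsa.ringInverse
  have hXS : X ∈ ({X, W} : Set A) := by simp
  have hWS : W ∈ ({X, W} : Set A) := by simp
  have hYT : Y ∈ ({Y, Ring.inverse Y} : Set A) := by simp
  have hR : R 3 ![Y * W, W * Y, X] = listCum R [Y * W, W * Y, X] := by
    unfold listCum
    congr 1
    ext i
    fin_cases i <;> rfl
  have hφX := map_inverse_freePoisson hst hXsa hWsa hXW hWX hl hmomX
  have hφW : φ W = l := by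
    have := hmomX 1
    rw [integral_freePoissonMeasure hl] at this
    simpa [integral_density_id hl] using this
  have hφWW : φ (W * W) = l * (1 + l) := by
    have := hmomX 2
    rw [integral_freePoissonMeasure hl, integral_density_sq hl, pow_two] at this
    exact_mod_cast this
  have hYW := moment_ab hmc hfree hYT hWS
  have hWY : φ (W * Y) = φ Y * φ W := by rw [htr, hYW]
  have hYWWY := moment_abba hmc hfree hYT hWS
  have hYWWYX := moment_abbac hmc hfree hYT hWS hXS
  have hWWX : φ (W * W * X) = φ W := by rw [mul_assoc, hWX, mul_one]
  have hYWX : φ (Y * W * X) = φ Y := by rw [mul_assoc, hWX, mul_one]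
  have hWYX : φ (W * Y * X) = φ Y := by rw [htr, ← mul_assoc, hXW, one_mul]
  have m3 := moment_three hmc (Y * W) (W * Y) X
  have mab := moment_two hmc (Y * W) (W * Y)
  have mac := moment_two hmc (Y * W) X
  have mbc := moment_two hmc (W * Y) X
  simp only [← moment_one hmc] at m3 mab mac mbc
  rw [hYWWYX, hWWX, hYW, hWY] at m3
  rw [hYWWY, hYW, hWY] at mab
  rw [hYWX, hYW] at mac
  rw [hWYX, hWY] at mbc
  have hl1 : (l : ℂ) - 1 ≠ 0 := by
    rw [sub_ne_zero]
    exact_mod_cast hl.ne'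
  have hrel : -φ W - φ (W * W) * φ X + 2 * φ W ^ 2 * φ X = 0 := by
    rw [hφW, hφWW, hφX]
    push_cast
    field_simp
    ring
  rw [hR]
  linear_combination -m3 + φ X * mab + φ Y * φ W * mac + φ Y * φ W * mbc + φ Y ^ 2 * hrel

end FreeProbLukacs
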